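/- arXiv:alg-geom/9412007 — 8 statements merged into one kernel-verified Lean document; each statement's English description precedes it below -/
import Mathlib

section
/- Let E and F be maximal isotropic subspaces of V. Then there exists an isometry g of (V,q) with det g = 1 and g(E) = F if and only if dim(E ∩ F) ≡ n (mod 2). -/
open Module

namespace QuadraticMap

variable {k V : Type*} [Field k] [AddCommGroup V] [Module k V]

theorem polar_eq_zero_of_isotropic {q : QuadraticForm k V} {E : Submodule k V}
    (hE : ∀ v ∈ E, q v = 0) {u v : V} (hu : u ∈ E) (hv : v ∈ E) : polar q u v = 0 := by
  simp [polar, hE _ (E.add_mem hu hv), hE u hu, hE v hv]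

theorem polar_map_eq {q : QuadraticForm k V} {g : V ≃ₗ[k] V} (hg : ∀ v, q (g v) = q v)
    (u v : V) : polar q (g u) (g v) = polar q u v := by
  simp [polar, ← map_add, hg]

/-- A Lagrangian subspace contains its orthogonal complement. -/
theorem mem_of_forall_polar_eq_zero [FiniteDimensional k V] {q : QuadraticForm k V}
    (hq : ∀ v : V, (∀ w : V, polar q v w = 0) → v = 0) {E : Submodule k V}
    (hdim : finrank k V = 2 * finrank k E) (hE : ∀ v ∈ E, q v = 0)
    {v : V} (hv : ∀ w ∈ E, polar q v w = 0) : v ∈ E := by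
  have hker : LinearMap.ker q.polarBilin = ⊥ := by
    refine (Submodule.eq_bot_iff _).2 fun x hx ↦ hq x fun w ↦ ?_
    simpa using LinearMap.congr_fun (LinearMap.mem_ker.1 hx) w
  have hrank := LinearMap.BilinForm.finrank_add_finrank_orthogonal' (B := q.polarBilin) E
  rw [hker, inf_bot_eq, finrank_bot] at hrank
  have hle : E ≤ LinearMap.BilinForm.orthogonal q.polarBilin E := fun x hx y hy ↦
    polar_eq_zero_of_isotropic hE hy hx
  rw [Submodule.eq_of_le_of_finrank_eq hle (by omega)]
  intro w hw
  change polar q w v = 0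
  rw [polar_comm, hv w hw]

/-- The pairing of `V ⧸ E` with an isotropic subspace `E` induced by the polar form. -/
def isotropicPairing (q : QuadraticForm k V) (E : Submodule k V) (hE : ∀ v ∈ E, q v = 0) :
    (V ⧸ E) →ₗ[k] Dual k E :=
  E.liftQ ((Dual.transpose (R := k) E.subtype).comp q.polarBilin) fun x hx ↦ by
    ext y
    exact polar_eq_zero_of_isotropic hE hx y.2

theorem isotropicPairing_mk (q : QuadraticForm k V) (E : Submodule k V)
    (hE : ∀ v ∈ E, q v = 0) (v : V) (w : E) :
    isotropicPairing q E hE (Submodule.Quotient.mk v) w = polar q v w := rfl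

/-- An isometry stabilizing a Lagrangian subspace has determinant one. -/
theorem det_eq_one_of_map_eq [FiniteDimensional k V] {q : QuadraticForm k V}
    (hq : ∀ v : V, (∀ w : V, polar q v w = 0) → v = 0) {E : Submodule k V}
    (hdim : finrank k V = 2 * finrank k E) (hE : ∀ v ∈ E, q v = 0)
    {g : V ≃ₗ[k] V} (hg : ∀ v, q (g v) = q v) (hgE : E.map (g : V →ₗ[k] V) = E) :
    LinearMap.det (g : V →ₗ[k] V) = 1 := by
  have hle : E ≤ E.comap (g : V →ₗ[k] V) := Submodule.map_le_iff_le_comap.1 hgE.le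
  have hinj : Function.Injective (isotropicPairing q E hE) := by
    rw [← LinearMap.ker_eq_bot, Submodule.eq_bot_iff]
    intro x hx
    obtain ⟨v, rfl⟩ := Submodule.Quotient.mk_surjective E x
    exact (Submodule.Quotient.mk_eq_zero E).2 <|
      mem_of_forall_polar_eq_zero hq hdim hE fun w hw ↦ LinearMap.congr_fun hx ⟨w, hw⟩
  have hfin : finrank k (V ⧸ E) = finrank k (Dual k E) := by
    have := E.finrank_quotient_add_finrank
    rw [Subspace.dual_finrank_eq]
    omega
  let φ := LinearEquiv.ofInjectiveOfFinrankEq (isotropicPairing q E hE) hinj hfin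
  let h := (g : V →ₗ[k] V).restrict hle
  have hcomp : (φ.symm ∘ₗ h.dualMap ∘ₗ φ) ∘ₗ E.mapQ E (g : V →ₗ[k] V) hle = LinearMap.id := by
    refine LinearMap.ext fun x ↦ ?_
    obtain ⟨v, rfl⟩ := Submodule.Quotient.mk_surjective E x
    refine φ.symm_apply_eq.2 (LinearMap.ext fun w ↦ ?_)
    exact polar_map_eq hg v w
  have hdet := congrArg LinearMap.det hcomp
  have hconj := LinearMap.det_conj h.dualMap φ.symm
  rw [LinearEquiv.symm_symm] at hconj
  rw [LinearMap.det_comp, hconj, LinearMap.det_dualMap, LinearMap.det_id] at hdet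
  rw [LinearMap.det_eq_det_mul_det E _ hle, hdet]

/-- Reflections along anisotropic vectors are isometries of determinant `-1`. -/
theorem exists_reflection [FiniteDimensional k V] (q : QuadraticForm k V) {v : V} (hv : q v ≠ 0) :
    ∃ s : V ≃ₗ[k] V, (∀ x, q (s x) = q x) ∧ LinearMap.det (s : V →ₗ[k] V) = -1 ∧
      ∀ x, s x = x - (polar q v x / q v) • v := by
  let f : Dual k V := (q v)⁻¹ • q.polarBilin v
  have hf : ∀ x, f x = polar q v x / q v := fun x ↦ by
    simp [f, div_eq_inv_mul]
  have hfv : f v = 2 := by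
    rw [hf, polar_self, nsmul_eq_mul, Nat.cast_ofNat, mul_div_cancel_right₀ _ hv]
  have happ : ∀ x, reflection hfv x = x - (polar q v x / q v) • v := fun x ↦ by
    rw [reflection_apply, hf]
  refine ⟨reflection hfv, fun x ↦ ?_, ?_, happ⟩
  · rw [happ, sub_eq_add_neg, ← neg_smul, QuadraticMap.map_add q, QuadraticMap.map_smul,
      polar_smul_right, polar_comm q x v, smul_eq_mul, smul_eq_mul]
    field_simp
    ring
  · have : (reflection hfv : V →ₗ[k] V) = LinearMap.transvection f (-v) := by
      ext x
      simp [reflection_apply, LinearMap.transvection.apply, sub_eq_add_neg]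
    rw [this, LinearMap.transvection.det, map_neg, hfv]
    norm_num

/-- Given two distinct Lagrangian subspaces, some reflection increases the dimension of their
intersection by one. -/
theorem exists_reflection_finrank_inf [FiniteDimensional k V] {q : QuadraticForm k V}
    (hq : ∀ v : V, (∀ w : V, polar q v w = 0) → v = 0) {E F : Submodule k V}
    (hFdim : finrank k V = 2 * finrank k F) (hE : ∀ v ∈ E, q v = 0) (hF : ∀ v ∈ F, q v = 0)
    (hEF : ¬ E ≤ F) :
    ∃ s : V ≃ₗ[k] V, (∀ x, q (s x) = q x) ∧ LinearMap.det (s : V →ₗ[k] V) = -1 ∧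
      finrank k ↥(E.map (s : V →ₗ[k] V) ⊓ F) = finrank k ↥(E ⊓ F) + 1 := by
  obtain ⟨e, he, f, hf, hef⟩ : ∃ e ∈ E, ∃ f ∈ F, polar q e f ≠ 0 := by
    by_contra! h
    exact hEF fun e he ↦ mem_of_forall_polar_eq_zero hq hFdim hF (h e he)
  have hqv : q (e - f) = -polar q e f := by
    rw [sub_eq_add_neg, QuadraticMap.map_add q, polar_neg_right, QuadraticMap.map_neg, hE e he,
      hF f hf]
    ring
  obtain ⟨s, hs, hdet, happ⟩ := exists_reflection q (v := e - f) (by simpa [hqv] using hef)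
  have hsE : ∀ y ∈ E, s y = y - (polar q f y / polar q e f) • (e - f) := fun y hy ↦ by
    rw [happ, hqv, polar_sub_left, polar_eq_zero_of_isotropic hE he hy, zero_sub, neg_div_neg_eq]
  have hse : s e = f := by
    rw [hsE e he, polar_comm q f e, div_self hef, one_smul, sub_sub_cancel]
  have hinf : E.map (s : V →ₗ[k] V) ⊓ F = (E ⊓ F) ⊔ k ∙ f := by
    apply le_antisymm
    · rintro _ ⟨⟨y, hy, rfl⟩, hyF⟩
      simp only [LinearEquiv.coe_coe] at hyF ⊢
      rw [hsE y hy] at hyF ⊢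
      set c := polar q f y / polar q e f
      refine Submodule.mem_sup.2 ⟨y - c • e, ⟨E.sub_mem hy (E.smul_mem c he), ?_⟩, c • f,
        Submodule.smul_mem _ c (Submodule.mem_span_singleton_self f), by module⟩
      have hsub : y - c • e = y - c • (e - f) - c • f := by module
      exact hsub ▸ F.sub_mem hyF (F.smul_mem c hf)
    · refine sup_le (fun x hx ↦ ⟨⟨x, hx.1, ?_⟩, hx.2⟩) ?_
      · simp [hsE x hx.1, polar_eq_zero_of_isotropic hF hf hx.2]
      · exact (Submodule.span_singleton_le_iff_mem _ _).2 ⟨⟨e, he, hse⟩, hf⟩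
  refine ⟨s, hs, hdet, ?_⟩
  rw [hinf]
  exact Submodule.finrank_sup_span_singleton fun h ↦
    hef (polar_eq_zero_of_isotropic hE he h.1)

/-- Any two Lagrangian subspaces are related by an isometry whose determinant is given by the
parity of the codimension of their intersection. -/
theorem exists_isometry_map_eq [FiniteDimensional k V] {q : QuadraticForm k V}
    (hq : ∀ v : V, (∀ w : V, polar q v w = 0) → v = 0) {F : Submodule k V}
    (hFdim : finrank k V = 2 * finrank k F) (hF : ∀ v ∈ F, q v = 0) (m : ℕ)
    (E : Submodule k V) (hEdim : finrank k E = finrank k F) (hE : ∀ v ∈ E, q v = 0)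
    (hm : finrank k ↥(E ⊓ F) + m = finrank k F) :
    ∃ g : V ≃ₗ[k] V, (∀ v, q (g v) = q v) ∧ LinearMap.det (g : V →ₗ[k] V) = (-1) ^ m ∧
      E.map (g : V →ₗ[k] V) = F := by
  induction m generalizing E with
  | zero =>
    have hEF : E = F := by
      rw [← Submodule.eq_of_le_of_finrank_eq (inf_le_left : E ⊓ F ≤ E) (by omega)]
      exact Submodule.eq_of_le_of_finrank_eq inf_le_right (by omega)
    exact ⟨LinearEquiv.refl k V, fun _ ↦ rfl, by simp, by simp [hEF]⟩
  | succ m ih =>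
    have hEF : ¬ E ≤ F := fun h ↦ by
      rw [inf_eq_left.2 h] at hm
      omega
    obtain ⟨s, hs, hdet, hrank⟩ := exists_reflection_finrank_inf hq hFdim hE hF hEF
    obtain ⟨g, hg, hgdet, hgE⟩ := ih (E.map (s : V →ₗ[k] V))
      ((LinearEquiv.finrank_map_eq s E).trans hEdim)
      (by rintro _ ⟨x, hx, rfl⟩; exact (hs x).trans (hE x hx)) (by omega)
    refine ⟨s.trans g, fun v ↦ (hg _).trans (hs v), ?_, ?_⟩
    · rw [LinearEquiv.coe_trans, LinearMap.det_comp, hgdet, hdet, pow_succ]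
    · rw [LinearEquiv.coe_trans, Submodule.map_comp, hgE]

end QuadraticMap

/-- Let `k` be a field of characteristic `≠ 2`, `V` a `k`-vector space of
dimension `2n` (`n ≥ 1`) and `q` a hyperbolic (nondegenerate) quadratic form on `V`.  If `E` and
`F` are maximal isotropic subspaces of `V`, then there is an isometry `g` of `(V, q)` with
`det g = 1` and `g(E) = F` iff `dim (E ⊓ F) ≡ n [MOD 2]`. -/
theorem stmt0 {k : Type*} [Field k] (hchar : (2 : k) ≠ 0)
    {V : Type*} [AddCommGroup V] [Module k V] [FiniteDimensional k V]
    (n : ℕ) (hn : 1 ≤ n) (hdim : finrank k V = 2 * n)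
    (q : QuadraticForm k V)
    (hnondeg : ∀ v : V, (∀ w : V, QuadraticMap.polar q v w = 0) → v = 0)
    (hhyp : ∃ L : Submodule k V, finrank k L = n ∧ ∀ v ∈ L, q v = 0)
    (E F : Submodule k V)
    (hEdim : finrank k E = n) (hEiso : ∀ v ∈ E, q v = 0)
    (hFdim : finrank k F = n) (hFiso : ∀ v ∈ F, q v = 0) :
    (∃ g : V ≃ₗ[k] V, (∀ v : V, q (g v) = q v) ∧
        LinearMap.det (g : V →ₗ[k] V) = 1 ∧ Submodule.map (g : V →ₗ[k] V) E = F) ↔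
      finrank k ↥(E ⊓ F) % 2 = n % 2 := by

  have hle : finrank k ↥(E ⊓ F) ≤ n := hEdim ▸ Submodule.finrank_mono inf_le_left
  obtain ⟨h, hh, hdet, hhE⟩ := QuadraticMap.exists_isometry_map_eq hnondeg (by rw [hdim, hFdim])
    hFiso (n - finrank k ↥(E ⊓ F)) E (hEdim.trans hFdim.symm) hEiso (by omega)
  have hparity : finrank k ↥(E ⊓ F) % 2 = n % 2 ↔ Even (n - finrank k ↥(E ⊓ F)) := by
    rw [Nat.even_iff]
    omega
  rw [hparity]
  refine ⟨fun ⟨g, hg, hgdet, hgE⟩ ↦ ?_, fun heven ↦ ⟨h, hh, by rw [hdet, heven.neg_one_pow], hhE⟩⟩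
  have hfix : E.map (g.trans h.symm : V →ₗ[k] V) = E := by
    rw [LinearEquiv.coe_trans, Submodule.map_comp, hgE, ← hhE, ← Submodule.map_comp]
    simp
  have hiso : ∀ v, q (g.trans h.symm v) = q v := fun v ↦ by
    rw [← hh, LinearEquiv.trans_apply, LinearEquiv.apply_symm_apply, hg]
  have hone := QuadraticMap.det_eq_one_of_map_eq hnondeg (by rw [hdim, hEdim]) hEiso hiso hfix
  have hcomp : (g : V →ₗ[k] V) = (h : V →ₗ[k] V) ∘ₗ (g.trans h.symm : V →ₗ[k] V) := by
    ext v
    simp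
  rw [hcomp, LinearMap.det_comp, hone, mul_one, hdet] at hgdet
  by_contra hodd
  rw [(Nat.not_even_iff_odd.1 hodd).neg_one_pow] at hgdet
  exact hchar (by linear_combination -hgdet)
end

section
/- Let E and F be maximal isotropic subspaces of V. Then there exists an isometry g of (V,q) with det g = 1 and g(E) = F. (That is, the special orthogonal group acts transitively on maximal isotropic subspaces in the odd-dimensional case.) -/
open Module

/-- A totally isotropic subspace of a nondegenerate quadratic space has at most half the
dimension. -/
theorem QuadraticForm.two_mul_finrank_le_of_isotropic {k V : Type*} [Field k]
    [AddCommGroup V] [Module k V] [FiniteDimensional k V] (q : QuadraticForm k V)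
    (hnondeg : ∀ v : V, (∀ w : V, QuadraticMap.polar q v w = 0) → v = 0)
    (W : Submodule k V) (hW : ∀ v ∈ W, q v = 0) : 2 * finrank k W ≤ finrank k V := by
  have hker : LinearMap.ker q.polarBilin = ⊥ := by
    rw [LinearMap.ker_eq_bot']
    intro v hv
    exact hnondeg v fun w => by simpa using LinearMap.congr_fun hv w
  have hle : W.map q.polarBilin ≤ W.dualAnnihilator := by
    rintro _ ⟨v, hv, rfl⟩
    rw [Submodule.mem_dualAnnihilator]
    intro w hw
    simp [QuadraticMap.polar, hW _ hv, hW _ hw, hW _ (W.add_mem hv hw)]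
  have h₁ : finrank k W ≤ finrank k W.dualAnnihilator :=
    (LinearEquiv.finrank_eq (Submodule.equivMapOfInjective q.polarBilin
      (LinearMap.ker_eq_bot.mp hker) W)).trans_le (Submodule.finrank_mono hle)
  have h₂ := Subspace.finrank_add_finrank_dualAnnihilator_eq W
  omega

/-- If `e` and `f` are isotropic vectors that are not orthogonal, the reflection in `e - f` is an
isometry exchanging `e` and `f` and fixing every vector orthogonal to both. -/
theorem QuadraticForm.exists_isometry_swap {k V : Type*} [Field k]
    [AddCommGroup V] [Module k V] (q : QuadraticForm k V) (e f : V)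
    (he : q e = 0) (hf : q f = 0) (hef : QuadraticMap.polar q e f ≠ 0) :
    ∃ s : V ≃ₗ[k] V, (∀ v, q (s v) = q v) ∧ LinearMap.det (s : V →ₗ[k] V) ^ 2 = 1 ∧ s e = f ∧
      ∀ v, QuadraticMap.polar q e v = 0 → QuadraticMap.polar q f v = 0 → s v = v := by
  have hx : q (e - f) = -QuadraticMap.polar q e f := by
    have := QuadraticMap.map_add q e (-f)
    rw [← sub_eq_add_neg, QuadraticMap.map_neg, QuadraticMap.polar_neg_right, he, hf] at this
    simpa using this
  have hx0 : q (e - f) ≠ 0 := by simpa [hx] using hef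
  let φ : Dual k V := (q (e - f))⁻¹ • q.polarBilin (e - f)
  have hφ (v : V) : φ v = (q (e - f))⁻¹ * QuadraticMap.polar q (e - f) v := rfl
  have h2 : φ (e - f) = 2 := by
    rw [hφ, QuadraticMap.polar_self]
    simp [mul_comm _ (q (e - f)), hx0]
  have hs (v : V) : reflection h2 v = v - φ v • (e - f) := reflection_apply _ h2
  refine ⟨reflection h2, fun v => ?_, ?_, ?_, fun v hev hfv => ?_⟩
  · rw [hs, sub_eq_add_neg, ← neg_smul, QuadraticMap.map_add q, QuadraticMap.map_smul,
      QuadraticMap.polar_smul_right, QuadraticMap.polar_comm, hφ]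
    simp only [smul_eq_mul]
    field_simp
    ring
  · rw [sq, ← LinearMap.det_comp]
    convert LinearMap.det_id (M := V) (A := k)
    ext v
    exact involutive_reflection h2 v
  · have : φ e = 1 := by
      rw [hφ, QuadraticMap.polar_sub_left, QuadraticMap.polar_self, he,
        QuadraticMap.polar_comm q f e, hx]
      field_simp
      simp
    rw [hs, this]
    simp
  · rw [hs, hφ, QuadraticMap.polar_sub_left, hev, hfv]
    simp

/-- In a nondegenerate quadratic space of dimension `2n+1`, any two `n`-dimensional totally
isotropic subspaces are exchanged by an isometry. -/
theorem QuadraticForm.exists_isometry_map_eq {k V : Type*} [Field k]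
    [AddCommGroup V] [Module k V] [FiniteDimensional k V]
    (n : ℕ) (hdim : finrank k V = 2 * n + 1) (q : QuadraticForm k V)
    (hnondeg : ∀ v : V, (∀ w : V, QuadraticMap.polar q v w = 0) → v = 0)
    (E F : Submodule k V) (hEdim : finrank k E = n) (hEiso : ∀ v ∈ E, q v = 0)
    (hFdim : finrank k F = n) (hFiso : ∀ v ∈ F, q v = 0) :
    ∃ g : V ≃ₗ[k] V, (∀ v : V, q (g v) = q v) ∧
      LinearMap.det (g : V →ₗ[k] V) ^ 2 = 1 ∧ Submodule.map (g : V →ₗ[k] V) E = F := by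
  induction hm : n - finrank k (E ⊓ F : Submodule k V) using Nat.strong_induction_on
    generalizing E with
  | _ m ih =>
    by_cases hEF : E = F
    · exact ⟨LinearEquiv.refl k V, fun _ => rfl, by simp, by simpa using hEF⟩
    have hlt : finrank k (E ⊓ F : Submodule k V) < n := by
      rw [← hFdim]
      refine Submodule.finrank_lt_finrank_of_lt (lt_of_le_of_ne inf_le_right fun h => hEF ?_)
      exact (Submodule.eq_of_le_of_finrank_eq (inf_eq_right.mp h) (hFdim.trans hEdim.symm)).symm
    obtain ⟨e, he, f, hf, hef⟩ : ∃ e ∈ E, ∃ f ∈ F, QuadraticMap.polar q e f ≠ 0 := by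
      by_contra! h
      have hsup := two_mul_finrank_le_of_isotropic q hnondeg (E ⊔ F) (by
        intro v hv
        obtain ⟨e, he, f, hf, rfl⟩ := Submodule.mem_sup.mp hv
        rw [QuadraticMap.map_add q, hEiso e he, hFiso f hf, h e he f hf]
        simp)
      have := Submodule.finrank_sup_add_finrank_inf_eq E F
      omega
    have horth (W : Submodule k V) (hW : ∀ v ∈ W, q v = 0) (v w : V) (hv : v ∈ W) (hw : w ∈ W) :
        QuadraticMap.polar q v w = 0 := by
      simp [QuadraticMap.polar, hW _ hv, hW _ hw, hW _ (W.add_mem hv hw)]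
    obtain ⟨s, hsq, hsdet, hse, hsfix⟩ :=
      exists_isometry_swap q e f (hEiso e he) (hFiso f hf) hef
    let E' := E.map (s : V →ₗ[k] V)
    have hE'dim : finrank k E' = n := (LinearEquiv.finrank_map_eq s E).trans hEdim
    have hE'iso : ∀ v ∈ E', q v = 0 := by
      rintro _ ⟨v, hv, rfl⟩
      exact (hsq v).trans (hEiso v hv)
    have hinf : E ⊓ F < E' ⊓ F := by
      refine SetLike.lt_iff_le_and_exists.mpr ⟨fun v hv => ⟨⟨v, hv.1, ?_⟩, hv.2⟩, f,
        Submodule.mem_inf.mpr ⟨⟨e, he, hse⟩, hf⟩,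
        fun h => hef (horth E hEiso e f he (Submodule.mem_inf.mp h).1)⟩
      exact hsfix v (horth E hEiso e v he hv.1) (horth F hFiso f v hf hv.2)
    have hinf' := Submodule.finrank_lt_finrank_of_lt hinf
    obtain ⟨g, hgq, hgdet, hgE⟩ := ih _ (by omega) E' hE'dim hE'iso rfl
    refine ⟨s.trans g, fun v => (hgq _).trans (hsq v), ?_, ?_⟩
    · rw [LinearEquiv.coe_trans, LinearMap.det_comp, mul_pow, hgdet, hsdet, one_mul]
    · rw [LinearEquiv.coe_trans, Submodule.map_comp, hgE]


open Module

/-- Let `k` be a field of characteristic `≠ 2`, `V` a `k`-vector space of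
dimension `2n+1` (`n ≥ 1`) and `q` a hyperbolic (nondegenerate) quadratic form on `V`.  If `E`
and `F` are maximal isotropic subspaces of `V`, then there is an isometry `g` of `(V, q)` with
`det g = 1` and `g(E) = F`:  `SO(q)` acts transitively on maximal isotropic subspaces in the
odd-dimensional case. -/
theorem stmt1 {k : Type*} [Field k] (hchar : (2 : k) ≠ 0)
    {V : Type*} [AddCommGroup V] [Module k V] [FiniteDimensional k V]
    (n : ℕ) (hn : 1 ≤ n) (hdim : finrank k V = 2 * n + 1)
    (q : QuadraticForm k V)
    (hnondeg : ∀ v : V, (∀ w : V, QuadraticMap.polar q v w = 0) → v = 0)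
    (hhyp : ∃ L : Submodule k V, finrank k L = n ∧ ∀ v ∈ L, q v = 0)
    (E F : Submodule k V)
    (hEdim : finrank k E = n) (hEiso : ∀ v ∈ E, q v = 0)
    (hFdim : finrank k F = n) (hFiso : ∀ v ∈ F, q v = 0) :
    ∃ g : V ≃ₗ[k] V, (∀ v : V, q (g v) = q v) ∧
      LinearMap.det (g : V →ₗ[k] V) = 1 ∧ Submodule.map (g : V →ₗ[k] V) E = F := by
  obtain ⟨g, hgq, hgdet, hgE⟩ :=
    QuadraticForm.exists_isometry_map_eq n hdim q hnondeg E F hEdim hEiso hFdim hFiso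
  rcases sq_eq_sq_iff_eq_or_eq_neg.mp (hgdet.trans (one_pow 2).symm) with h | h
  · exact ⟨g, hgq, h, hgE⟩
  · have hneg : ((g.trans (LinearEquiv.neg k) : V ≃ₗ[k] V) : V →ₗ[k] V) =
        -(g : V →ₗ[k] V) := by
      ext v
      simp
    refine ⟨g.trans (LinearEquiv.neg k), fun v => ?_, ?_, ?_⟩
    · simpa using hgq v
    · rw [hneg, ← neg_one_smul k, LinearMap.det_smul, h, hdim]
      simp [pow_succ, pow_mul]
    · rw [hneg, Submodule.map_neg, hgE]
end

section
/- Let E, F, G be maximal isotropic subspaces of V. Then dim(E ∩ F) + dim(F ∩ G) + dim(E ∩ G) ≡ n (mod 2). (This is the coherence fact making the partition of maximal isotropic subspaces into two 'families' well defined: E and F are in the same family when dim(E ∩ F) ≡ n (mod 2).) -/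
open Module

theorem LinearMap.BilinForm.IsAlt.even_finrank_of_nondegenerate {k W : Type*} [Field k] (h2 : (2 : k) ≠ 0)
    [AddCommGroup W] [Module k W] [FiniteDimensional k W] {B : LinearMap.BilinForm k W}
    (hB : B.IsAlt) (hnd : B.Nondegenerate) : Even (finrank k W) := by
  have hdet := (LinearMap.BilinForm.nondegenerate_iff_det_ne_zero (finBasis k W)).1 hnd
  set M := LinearMap.BilinForm.toMatrix (finBasis k W) B with hM
  have hT : M.transpose = -M := by
    ext i j
    simp [hM, LinearMap.BilinForm.toMatrix_apply, ← hB.neg_eq (finBasis k W i)]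
  by_contra hodd
  have h := M.det_transpose
  rw [hT, Matrix.det_neg, Fintype.card_fin, (Nat.not_even_iff_odd.1 hodd).neg_one_pow] at h
  apply hdet
  have : (2 : k) * M.det = 0 := by linear_combination -h
  exact (mul_eq_zero.1 this).resolve_left h2

theorem LinearMap.BilinForm.IsAlt.even_finrank_range {k W : Type*} [Field k] (h2 : (2 : k) ≠ 0)
    [AddCommGroup W] [Module k W] [FiniteDimensional k W] {B : LinearMap.BilinForm k W}
    (hB : B.IsAlt) : Even (finrank k (LinearMap.range B)) := by
  obtain ⟨C, hC⟩ := Submodule.exists_isCompl (LinearMap.ker B)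
  have hdim := Submodule.finrank_add_eq_of_isCompl hC
  have hrank := LinearMap.finrank_range_add_finrank_ker B
  have hBC : (B.restrict C).IsAlt := fun x => hB x
  have hnd : (B.restrict C).Nondegenerate := by
    refine hBC.isRefl.nondegenerate_iff_separatingLeft.2 fun x hx => ?_
    have hxker : (x : W) ∈ LinearMap.ker B := by
      refine LinearMap.mem_ker.2 (LinearMap.ext fun y => ?_)
      obtain ⟨z, hz, c, hc, rfl⟩ :=
        Submodule.mem_sup.1 (hC.sup_eq_top ▸ Submodule.mem_top : y ∈ LinearMap.ker B ⊔ C)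
      have h₁ : B x z = 0 := hB.isRefl z x (by rw [LinearMap.mem_ker.1 hz]; rfl)
      have h₂ : B x c = 0 := hx ⟨c, hc⟩
      simp [h₁, h₂]
    exact Subtype.ext (Submodule.disjoint_def.1 hC.disjoint x hxker x.2)
  have := hBC.even_finrank_of_nondegenerate h2 hnd
  rwa [show finrank k (LinearMap.range B) = finrank k C by lia]

theorem Submodule.exists_linearMap_mem_sub_mem {k V : Type*} [Field k]
    [AddCommGroup V] [Module k V] (E F : Submodule k V) :
    ∃ σ : ↥(E ⊔ F) →ₗ[k] V, ∀ u : ↥(E ⊔ F), σ u ∈ E ∧ (u : V) - σ u ∈ F := by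
  let f : E × F →ₗ[k] ↥(E ⊔ F) :=
    (Submodule.inclusion le_sup_left).coprod (Submodule.inclusion le_sup_right)
  have hf : LinearMap.range f = ⊤ := by
    refine LinearMap.range_eq_top.2 fun ⟨u, hu⟩ => ?_
    obtain ⟨e, he, g, hg, rfl⟩ := Submodule.mem_sup.1 hu
    exact ⟨(⟨e, he⟩, ⟨g, hg⟩), rfl⟩
  obtain ⟨s, hs⟩ := f.exists_rightInverse_of_surjective hf
  refine ⟨E.subtype ∘ₗ LinearMap.fst k E F ∘ₗ s, fun u => ⟨(s u).1.2, ?_⟩⟩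
  have h : (u : V) = (s u).1 + (s u).2 := congrArg Subtype.val (LinearMap.congr_fun hs u).symm
  simp [h]

theorem LinearMap.BilinForm.orthogonal_sup {k V : Type*} [Field k]
    [AddCommGroup V] [Module k V] (B : LinearMap.BilinForm k V) (E F : Submodule k V) :
    B.orthogonal (E ⊔ F) = B.orthogonal E ⊓ B.orthogonal F := by
  refine le_antisymm (le_inf (LinearMap.BilinForm.orthogonal_le le_sup_left)
    (LinearMap.BilinForm.orthogonal_le le_sup_right)) ?_
  rintro x ⟨hE, hF⟩ y hy
  obtain ⟨e, he, f, hf, rfl⟩ := Submodule.mem_sup.1 hy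
  have h₁ : B e x = 0 := hE e he
  have h₂ : B f x = 0 := hF f hf
  simp [h₁, h₂]

theorem QuadraticMap.polar_eq_zero_of_isotropic_s2 {k V : Type*} [Field k]
    [AddCommGroup V] [Module k V] {q : QuadraticForm k V} {E : Submodule k V}
    (hE : ∀ v ∈ E, q v = 0) {v w : V} (hv : v ∈ E) (hw : w ∈ E) : polar q v w = 0 := by
  simp [polar, hE _ hv, hE _ hw, hE _ (E.add_mem hv hw)]

theorem QuadraticForm.orthogonal_eq_self_of_isotropic {k V : Type*} [Field k]
    [AddCommGroup V] [Module k V] [FiniteDimensional k V] {q : QuadraticForm k V}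
    (hnd : LinearMap.BilinForm.Nondegenerate q.polarBilin) {E : Submodule k V}
    (hE : ∀ v ∈ E, q v = 0) (hdim : finrank k V = 2 * finrank k E) :
    LinearMap.BilinForm.orthogonal q.polarBilin E = E := by
  have hle : E ≤ LinearMap.BilinForm.orthogonal q.polarBilin E :=
    fun v hv w hw => QuadraticMap.polar_eq_zero_of_isotropic_s2 hE hw hv
  refine (Submodule.eq_of_le_of_finrank_eq hle ?_).symm
  rw [LinearMap.BilinForm.finrank_orthogonal hnd]
  lia

/-- Let `k` be a field of characteristic `≠ 2`, `V` a `k`-vector space of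
dimension `2n` (`n ≥ 1`) and `q` a hyperbolic (nondegenerate) quadratic form on `V`.  If `E`,
`F`, `G` are maximal isotropic subspaces of `V`, then
`dim (E ⊓ F) + dim (F ⊓ G) + dim (E ⊓ G) ≡ n [MOD 2]`. -/
theorem stmt2 {k : Type*} [Field k] (hchar : (2 : k) ≠ 0)
    {V : Type*} [AddCommGroup V] [Module k V] [FiniteDimensional k V]
    (n : ℕ) (hn : 1 ≤ n) (hdim : finrank k V = 2 * n)
    (q : QuadraticForm k V)
    (hnondeg : ∀ v : V, (∀ w : V, QuadraticMap.polar q v w = 0) → v = 0)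
    (hhyp : ∃ L : Submodule k V, finrank k L = n ∧ ∀ v ∈ L, q v = 0)
    (E F G : Submodule k V)
    (hEdim : finrank k E = n) (hEiso : ∀ v ∈ E, q v = 0)
    (hFdim : finrank k F = n) (hFiso : ∀ v ∈ F, q v = 0)
    (hGdim : finrank k G = n) (hGiso : ∀ v ∈ G, q v = 0) :
    (finrank k ↥(E ⊓ F) + finrank k ↥(F ⊓ G) + finrank k ↥(E ⊓ G)) % 2 = n % 2 := by
  let B : LinearMap.BilinForm k V := q.polarBilin
  have hB (v w : V) : B v w = QuadraticMap.polar q v w := rfl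
  have hrefl : B.IsRefl := fun v w h => by rwa [hB, QuadraticMap.polar_comm]
  have hnd : B.Nondegenerate := hrefl.nondegenerate_iff_separatingLeft.2 hnondeg
  have hEo : B.orthogonal E = E :=
    QuadraticForm.orthogonal_eq_self_of_isotropic hnd hEiso (by lia)
  have hFo : B.orthogonal F = F :=
    QuadraticForm.orthogonal_eq_self_of_isotropic hnd hFiso (by lia)
  have hGo : B.orthogonal G = G :=
    QuadraticForm.orthogonal_eq_self_of_isotropic hnd hGiso (by lia)
  have hEF : B.orthogonal (E ⊓ F) = E ⊔ F := by
    rw [← LinearMap.BilinForm.orthogonal_orthogonal hnd hrefl (E ⊔ F),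
      LinearMap.BilinForm.orthogonal_sup, hEo, hFo]
  have hUo : B.orthogonal (E ⊓ F ⊔ G) = (E ⊔ F) ⊓ G := by
    rw [LinearMap.BilinForm.orthogonal_sup, hEF, hGo]
  have hUoo : B.orthogonal ((E ⊔ F) ⊓ G) = E ⊓ F ⊔ G := by
    rw [← hUo, LinearMap.BilinForm.orthogonal_orthogonal hnd hrefl]
  obtain ⟨σ, hσ⟩ := Submodule.exists_linearMap_mem_sub_mem E F
  let τ : ↥((E ⊔ F) ⊓ G) →ₗ[k] V := σ ∘ₗ Submodule.inclusion inf_le_left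
  have hτE (u) : τ u ∈ E := (hσ _).1
  have hτF (u : ↥((E ⊔ F) ⊓ G)) : (u : V) - τ u ∈ F := (hσ (Submodule.inclusion inf_le_left u)).2
  -- For u in (E ⊔ F) ⊓ G, the vector τ u is the E-component of u modulo E ⊓ F, and ω u v = B (τ u) v.
  let ω : LinearMap.BilinForm k ↥((E ⊔ F) ⊓ G) := B.compl₁₂ τ (Submodule.subtype _)
  have hω (u u') : ω u u' = B (τ u) u' := rfl
  have hωalt : ω.IsAlt := fun u => by
    have h₁ : B (τ u) (τ u) = 0 :=
      QuadraticMap.polar_eq_zero_of_isotropic_s2 hEiso (hτE u) (hτE u)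
    have h₂ : B (τ u) (u - τ u) = 0 := by
      rw [hB, QuadraticMap.polar, add_sub_cancel, hGiso _ u.2.2, hEiso _ (hτE u),
        hFiso _ (hτF u)]
      simp
    rw [hω, ← sub_add_cancel (u : V) (τ u), map_add, h₁, h₂, add_zero]
  have hker : LinearMap.ker ω = (E ⊓ G ⊔ F ⊓ G).comap ((E ⊔ F) ⊓ G).subtype := by
    ext u
    have hmem : u ∈ LinearMap.ker ω ↔ τ u ∈ E ⊓ F ⊔ G := by
      rw [← hUoo, LinearMap.mem_ker, LinearMap.BilinForm.mem_orthogonal_iff]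
      exact ⟨fun h v hv => hrefl _ _ (LinearMap.congr_fun h ⟨v, hv⟩),
        fun h => LinearMap.ext fun v => hrefl _ _ (h v v.2)⟩
    rw [hmem, Submodule.mem_comap, Submodule.subtype_apply]
    constructor
    · intro h
      obtain ⟨x, hx, g, hg, hxg⟩ := Submodule.mem_sup.1 h
      have hgE : g ∈ E := by
        rw [← add_sub_cancel_left x g, hxg]
        exact E.sub_mem (hτE u) hx.1
      have hF : (u : V) - g ∈ F := by
        have := F.add_mem (hτF u) hx.2
        rwa [← hxg, sub_add_eq_sub_sub, sub_right_comm, sub_add_cancel] at this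
      exact Submodule.mem_sup.2 ⟨g, ⟨hgE, hg⟩, u - g, ⟨hF, G.sub_mem u.2.2 hg⟩, by abel⟩
    · intro h
      obtain ⟨e, he, f, hf, hef⟩ := Submodule.mem_sup.1 h
      refine Submodule.mem_sup.2 ⟨τ u - e, ⟨E.sub_mem (hτE u) he.1, ?_⟩, e, he.2, by abel⟩
      have := F.sub_mem hf.1 (hτF u)
      rwa [← hef, show f - (e + f - τ u) = τ u - e by abel] at this
  have heven := hωalt.even_finrank_range hchar
  have hrank := LinearMap.finrank_range_add_finrank_ker ω
  have hle : E ⊓ G ⊔ F ⊓ G ≤ (E ⊔ F) ⊓ G :=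
    sup_le (inf_le_inf_right _ le_sup_left) (inf_le_inf_right _ le_sup_right)
  rw [hker, (Submodule.comapSubtypeEquivOfLe hle).finrank_eq] at hrank
  have h₁ := Submodule.finrank_sup_add_finrank_inf_eq (E ⊓ G) (F ⊓ G)
  have h₂ := Submodule.finrank_sup_add_finrank_inf_eq (E ⊓ F) G
  have h₃ := LinearMap.BilinForm.finrank_orthogonal hnd (E ⊓ F ⊔ G)
  have h₄ := Submodule.finrank_le (E ⊓ F ⊔ G)
  rw [← inf_inf_distrib_right] at h₁
  rw [hUo] at h₃
  obtain ⟨m, hm⟩ := heven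
  lia
end

section
/- Let E₁ ⊂ E₂ ⊂ … ⊂ E_n and F₁ ⊂ F₂ ⊂ … ⊂ F_n be two flags of totally isotropic subspaces of V with dim E_i = dim F_i = i for all i (so E_n and F_n are maximal isotropic). Then there exists an isometry g of (V,q) with det g = 1 and g(E_i) = F_i for all i = 1, …, n if and only if dim(E_n ∩ F_n) ≡ n (mod 2). -/
open Module

namespace LinearMap.BilinForm

variable {k V : Type*} [Field k] [AddCommGroup V] [Module k V] {B : LinearMap.BilinForm k V}

/-- The reflection swapping two isotropic vectors `x`, `y` with `B x y ≠ 0`. -/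
theorem exists_reflection_swap [FiniteDimensional k V] (hB : B.IsSymm) {x y : V} (hx : B x x = 0)
    (hy : B y y = 0) (hxy : B x y ≠ 0) :
    ∃ s : V ≃ₗ[k] V, (∀ v w, B (s v) (s w) = B v w) ∧ LinearMap.det (s : V →ₗ[k] V) = -1 ∧
      ∀ v, s v = v + ((B x y)⁻¹ * (B x v - B y v)) • (x - y) := by
  have hyx : B y x = B x y := hB.eq y x
  set f : Dual k V := -(B x y)⁻¹ • B (x - y) with hf
  have hfv : ∀ v, f v = -((B x y)⁻¹ * (B x v - B y v)) := fun v ↦ by simp [hf]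
  have h2 : f (x - y) = 2 := by
    rw [hfv]
    simp only [map_sub, hx, hy, hyx]
    field_simp
    ring
  have hs : ∀ v, Module.reflection h2 v = v + ((B x y)⁻¹ * (B x v - B y v)) • (x - y) := fun v ↦ by
    rw [Module.reflection_apply, hfv]
    module
  refine ⟨Module.reflection h2, fun v w ↦ ?_, ?_, hs⟩
  · simp only [hs, map_add, map_smul, map_sub, LinearMap.add_apply, LinearMap.smul_apply,
      LinearMap.sub_apply, smul_eq_mul, hx, hy, hyx, hB.eq v x, hB.eq v y]
    rw [← sub_eq_zero]
    field_simp
    ring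
  · have : (Module.reflection h2 : V →ₗ[k] V) = LinearMap.transvection (-f) (x - y) := by
      ext v
      rw [LinearEquiv.coe_coe, Module.reflection_apply, LinearMap.transvection.apply,
        LinearMap.neg_apply]
      module
    rw [this, LinearMap.transvection.det, LinearMap.neg_apply, h2]
    norm_num

theorem finrank_eq_two_mul_of_orthogonal_eq_self [FiniteDimensional k V] (hnd : B.Nondegenerate)
    {L : Submodule k V} (hL : B.orthogonal L = L) : finrank k V = 2 * finrank k L := by
  have h := finrank_orthogonal hnd L
  have := L.finrank_le
  rw [hL] at h
  omega

theorem orthogonal_eq_self_of_finrank [FiniteDimensional k V] (hnd : B.Nondegenerate)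
    {L : Submodule k V} (hiso : ∀ v ∈ L, ∀ w ∈ L, B v w = 0)
    (hdim : finrank k V = 2 * finrank k L) : B.orthogonal L = L := by
  have hle : L ≤ B.orthogonal L := fun v hv w hw ↦ hiso w hw v hv
  refine (Submodule.eq_of_le_of_finrank_eq hle ?_).symm
  rw [finrank_orthogonal hnd]
  omega

theorem apply_eq_zero_of_orthogonal_eq_self {L : Submodule k V} (hL : B.orthogonal L = L) {v w : V}
    (hv : v ∈ L) (hw : w ∈ L) : B v w = 0 :=
  (hL.ge hw : w ∈ B.orthogonal L) v hv

/-- A basis of a Lagrangian subspace extends to a hyperbolic basis of the whole space. -/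
theorem exists_hyperbolic_basis [FiniteDimensional k V] (h2 : (2 : k) ≠ 0) (hB : B.IsSymm)
    (hnd : B.Nondegenerate) {L : Submodule k V} (hL : B.orthogonal L = L) {ι : Type*} [Fintype ι]
    [DecidableEq ι] (e : Basis ι k L) :
    ∃ b : Basis (ι ⊕ ι) k V, (∀ i, b (Sum.inl i) = e i) ∧
      ∀ s t, B (b s) (b t) = if s = t.swap then 1 else 0 := by
  have hiso : ∀ i j, B (e i : V) (e j) = 0 := fun i j ↦
    apply_eq_zero_of_orthogonal_eq_self hL (e i).2 (e j).2
  choose φ hφ using fun i ↦ LinearMap.exists_extend (e.coord i)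
  set d : ι → V := fun i ↦ (B.toDual hnd).symm (φ i) with hd
  have hde : ∀ i j, B (d i) (e j) = if i = j then 1 else 0 := fun i j ↦ by
    rw [hd, apply_toDual_symm_apply]
    have := LinearMap.congr_fun (hφ i) (e j)
    simp only [LinearMap.comp_apply, Submodule.subtype_apply] at this
    rw [this, Basis.coord_apply, Basis.repr_self, Finsupp.single_apply]
    simp only [eq_comm]
  have hed : ∀ i j, B (e i : V) (d j) = if i = j then 1 else 0 := fun i j ↦ by
    rw [hB.eq, hde]
    simp only [eq_comm]
  set f : ι → V := fun i ↦ d i - ∑ j, (2⁻¹ * B (d i) (d j)) • (e j : V) with hf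
  have hef : ∀ i j, B (e i : V) (f j) = if i = j then 1 else 0 := fun i j ↦ by
    simp [hf, hed, hiso]
  have hfe : ∀ i j, B (f i) (e j) = if i = j then 1 else 0 := fun i j ↦ by
    rw [hB.eq, hef]
    simp only [eq_comm]
  have hff : ∀ i j, B (f i) (f j) = 0 := fun i j ↦ by
    have h1 : B (f i) (f j) = B (f i) (d j) - 2⁻¹ * B (d j) (d i) := by
      rw [show f j = d j - ∑ l, (2⁻¹ * B (d j) (d l)) • (e l : V) from rfl, map_sub, map_sum]
      simp [hfe]
    rw [h1]
    simp only [hf, map_sub, map_sum, map_smul, smul_eq_mul, LinearMap.sub_apply,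
      LinearMap.sum_apply, LinearMap.smul_apply, hed]
    simp only [mul_ite, mul_one, mul_zero, Finset.sum_ite_eq', Finset.mem_univ, if_true]
    rw [hB.eq (d j) (d i)]
    field_simp
    ring
  set v : ι ⊕ ι → V := Sum.elim (fun i ↦ (e i : V)) f with hv
  have hgram : ∀ s t, B (v s) (v t) = if s = t.swap then 1 else 0 := by
    rintro (i | i) (j | j) <;> simp [hv, hiso, hef, hfe, hff]
  have hli : LinearIndependent k v := by
    rw [Fintype.linearIndependent_iff]
    intro c hc s
    have h := congrArg (B (v s.swap)) hc
    simpa only [map_sum, map_smul, smul_eq_mul, hgram, map_zero,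
      Sum.swap_leftInverse.injective.eq_iff, mul_ite, mul_one, mul_zero, Finset.sum_ite_eq,
      Finset.mem_univ, if_true] using h
  have hcard : Fintype.card (ι ⊕ ι) = finrank k V := by
    rw [finrank_eq_two_mul_of_orthogonal_eq_self hnd hL, finrank_eq_card_basis e,
      Fintype.card_sum, two_mul]
  rcases isEmpty_or_nonempty ι with hι | hι
  · have : finrank k V = 0 := by simp [← hcard]
    have : Subsingleton V := finrank_zero_iff.mp this
    exact ⟨Basis.empty V, fun i ↦ isEmptyElim i, fun s ↦ isEmptyElim s⟩
  · refine ⟨basisOfLinearIndependentOfCardEqFinrank hli hcard, fun i ↦ ?_, fun s t ↦ ?_⟩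
    · simp [hv]
    · simpa using hgram s t

/-- An isometry stabilizing a Lagrangian subspace has determinant one. -/
theorem det_eq_one_of_map_eq_self [FiniteDimensional k V] (h2 : (2 : k) ≠ 0) (hB : B.IsSymm)
    (hnd : B.Nondegenerate) {L : Submodule k V} (hL : B.orthogonal L = L) (g : V ≃ₗ[k] V)
    (hg : ∀ v w, B (g v) (g w) = B v w) (hgL : L.map (g : V →ₗ[k] V) = L) :
    LinearMap.det (g : V →ₗ[k] V) = 1 := by
  classical
  obtain ⟨b, hbe, hb⟩ := exists_hyperbolic_basis h2 hB hnd hL (Module.finBasis k L)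
  have hrepr : ∀ s v, b.repr v s = B (b s.swap) v := fun s v ↦ by
    conv_rhs => rw [← b.sum_repr v]
    simp only [map_sum, map_smul, smul_eq_mul, hb, Sum.swap_leftInverse.injective.eq_iff, mul_ite,
      mul_one, mul_zero, Finset.sum_ite_eq, Finset.mem_univ, if_true]
  have hzero : ∀ i j, B (b (Sum.inl i)) (g (b (Sum.inl j))) = 0 := fun i j ↦ by
    rw [hbe, hbe]
    exact apply_eq_zero_of_orthogonal_eq_self hL (Subtype.prop _)
      (hgL.le (Submodule.mem_map_of_mem (Subtype.prop _)))
  set M := LinearMap.toMatrix b b (g : V →ₗ[k] V) with hM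
  have hMapp : ∀ s t, M s t = B (b s.swap) (g (b t)) := fun s t ↦ by
    rw [hM, LinearMap.toMatrix_apply, hrepr]
    rfl
  have h21 : M.toBlocks₂₁ = 0 := by
    ext i j
    simp [Matrix.toBlocks₂₁, hMapp, hzero]
  have h1 : M.toBlocks₁₁.transpose * M.toBlocks₂₂ = 1 := by
    ext i j
    have h := hg (b (Sum.inl i)) (b (Sum.inr j))
    rw [← b.sum_repr (g (b (Sum.inl i)))] at h
    simp only [Fintype.sum_sum_type, hrepr, Sum.swap_inl, Sum.swap_inr, hzero, zero_smul,
      Finset.sum_const_zero, add_zero, map_sum, map_smul, LinearMap.sum_apply,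
      LinearMap.smul_apply, hb, smul_eq_mul] at h
    simp only [Matrix.mul_apply, Matrix.transpose_apply, Matrix.toBlocks₁₁, Matrix.toBlocks₂₂,
      Matrix.of_apply, hMapp, Sum.swap_inl, Sum.swap_inr, h, Matrix.one_apply, Sum.inl.injEq]
  rw [← LinearMap.det_toMatrix b, ← hM, ← Matrix.fromBlocks_toBlocks M, h21,
    Matrix.det_fromBlocks_zero₂₁, ← Matrix.det_transpose M.toBlocks₁₁, ← Matrix.det_mul, h1,
    Matrix.det_one]

theorem orthogonal_map_eq_self {L : Submodule k V} (hL : B.orthogonal L = L) (g : V ≃ₗ[k] V)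
    (hg : ∀ v w, B (g v) (g w) = B v w) :
    B.orthogonal (L.map (g : V →ₗ[k] V)) = L.map (g : V →ₗ[k] V) := by
  ext v
  obtain ⟨v, rfl⟩ := g.surjective v
  have h : g v ∈ L.map (g : V →ₗ[k] V) ↔ v ∈ L := by simp
  rw [h]
  conv_rhs => rw [← hL]
  refine ⟨fun hv w hw ↦ ?_, ?_⟩
  · rw [← hg]
    exact hv _ (Submodule.mem_map_of_mem hw)
  · rintro hv _ ⟨w, hw, rfl⟩
    exact (hg w v).trans (hv w hw)

/-- The determinant of an isometry is read off from the relative position of a Lagrangian subspace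
and its image. -/
theorem det_eq_neg_one_pow [FiniteDimensional k V] (h2 : (2 : k) ≠ 0) (hB : B.IsSymm)
    (hnd : B.Nondegenerate) {L : Submodule k V} (hL : B.orthogonal L = L) (m : ℕ) (g : V ≃ₗ[k] V)
    (hg : ∀ v w, B (g v) (g w) = B v w)
    (hm : finrank k ↥(L ⊓ L.map (g : V →ₗ[k] V)) + m = finrank k L) :
    LinearMap.det (g : V →ₗ[k] V) = (-1) ^ m := by
  induction m generalizing g with
  | zero =>
    have h := Submodule.eq_of_le_of_finrank_eq inf_le_left hm
    have h' := Submodule.eq_of_le_of_finrank_eq (inf_eq_left.mp h) (g.finrank_map_eq L).symm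
    rw [pow_zero, det_eq_one_of_map_eq_self h2 hB hnd hL g hg h'.symm]
  | succ m ih =>
    have hM := orthogonal_map_eq_self hL g hg
    set M := L.map (g : V →ₗ[k] V) with hMdef
    have hLiso : ∀ v ∈ L, ∀ w ∈ L, B v w = 0 := fun v hv w hw ↦
      apply_eq_zero_of_orthogonal_eq_self hL hv hw
    have hMiso : ∀ v ∈ M, ∀ w ∈ M, B v w = 0 := fun v hv w hw ↦
      apply_eq_zero_of_orthogonal_eq_self hM hv hw
    obtain ⟨x, hx, y, hy, hxy⟩ : ∃ x ∈ L, ∃ y ∈ M, B x y ≠ 0 := by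
      by_contra! h
      have hle : L ≤ M := by
        rw [← hM]
        exact fun x hx y hy ↦ (hB.eq y x).trans (h x hx y hy)
      rw [inf_eq_left.mpr hle] at hm
      omega
    obtain ⟨s, hs, hdet, hsapp⟩ :=
      exists_reflection_swap hB (hLiso x hx x hx) (hMiso y hy y hy) hxy
    have hxM : x ∉ L ⊓ M := fun h ↦ hxy (hMiso x h.2 y hy)
    have hsy : s y = x := by
      rw [hsapp, hMiso y hy y hy, sub_zero, inv_mul_cancel₀ hxy]
      module
    have hsM : ∀ z ∈ M, s z = z + ((B x y)⁻¹ * B x z) • (x - y) := fun z hz ↦ by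
      rw [hsapp, hMiso y hy z hz, sub_zero]
    have hinf : L ⊓ M.map (s : V →ₗ[k] V) = (L ⊓ M) ⊔ k ∙ x := by
      apply le_antisymm
      · rintro _ ⟨hL', z, hz, rfl⟩
        rw [SetLike.mem_coe] at hz
        change s z ∈ L at hL'
        change s z ∈ _
        rw [hsM z hz] at hL' ⊢
        set c := (B x y)⁻¹ * B x z
        have hzc : z - c • y ∈ L ⊓ M := by
          refine ⟨?_, M.sub_mem hz (M.smul_mem _ hy)⟩
          have h := L.sub_mem hL' (L.smul_mem c hx)
          rwa [show z + c • (x - y) - c • x = z - c • y by module] at h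
        refine Submodule.mem_sup.mpr ⟨_, hzc, c • x,
          Submodule.smul_mem _ _ (Submodule.mem_span_singleton_self x), by module⟩
      · refine sup_le (fun w hw ↦ ⟨hw.1, w, hw.2, ?_⟩) ?_
        · change s w = w
          rw [hsM w hw.2, hLiso x hx w hw.1]
          simp
        · rw [Submodule.span_singleton_le_iff_mem]
          exact ⟨hx, y, hy, hsy⟩
    have hmap : L.map ((g.trans s : V ≃ₗ[k] V) : V →ₗ[k] V) = M.map (s : V →ₗ[k] V) := by
      rw [LinearEquiv.coe_trans, Submodule.map_comp]
    have key := ih (g.trans s) (fun v w ↦ by simp [hs, hg]) (by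
      rw [hmap, hinf, Submodule.finrank_sup_span_singleton hxM]
      omega)
    rw [LinearEquiv.coe_trans, LinearMap.det_comp, hdet] at key
    rw [pow_succ, ← key]
    ring

end LinearMap.BilinForm

/-- A complete flag of subspaces comes from an adapted family of vectors. -/
theorem exists_adapted_family {k V : Type*} [Field k] [AddCommGroup V] [Module k V]
    [FiniteDimensional k V] {n : ℕ} (E : Fin n → Submodule k V) (hmono : Monotone E)
    (hdim : ∀ i, finrank k ↥(E i) = (i : ℕ) + 1) :
    ∃ e : Fin n → V, LinearIndependent k e ∧ ∀ i, E i = Submodule.span k (e '' Set.Iic i) := by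
  have hex : ∀ i, ∃ v ∈ E i, v ∉ ⨆ j < i, E j := fun i ↦ by
    refine SetLike.not_le_iff_exists.mp fun h ↦ ?_
    have hrank := Submodule.finrank_mono h
    rw [hdim] at hrank
    obtain ⟨m, hm⟩ := i
    cases m with
    | zero =>
      rw [show ⨆ j < (⟨0, hm⟩ : Fin n), E j = ⊥ by simp [Fin.lt_def], finrank_bot] at hrank
      omega
    | succ m =>
      have hle : ⨆ j < (⟨m + 1, hm⟩ : Fin n), E j ≤ E ⟨m, by omega⟩ :=
        iSup₂_le fun j hj ↦ hmono (Fin.le_def.mpr (Nat.lt_succ_iff.mp hj))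
      have h' := hrank.trans (Submodule.finrank_mono hle)
      rw [hdim] at h'
      simp at h'
  choose e he he' using hex
  have hspan_le : ∀ i, Submodule.span k (e '' Set.Iic i) ≤ E i := fun i ↦ by
    rw [Submodule.span_le]
    rintro _ ⟨j, hj, rfl⟩
    exact hmono hj (he j)
  have hli : LinearIndependent k e := by
    by_contra hcon
    obtain ⟨c, hc, i₀, hi₀⟩ := Fintype.not_linearIndependent_iff.mp hcon
    classical
    set S := Finset.univ.filter fun i ↦ c i ≠ 0
    have hS : S.Nonempty := ⟨i₀, by simp [S, hi₀]⟩
    have hi : c (S.max' hS) ≠ 0 := (Finset.mem_filter.mp (S.max'_mem hS)).2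
    have hmax : ∀ j, c j ≠ 0 → j ≤ S.max' hS := fun j hj ↦ S.le_max' j (by simp [S, hj])
    set i := S.max' hS
    rw [← Finset.add_sum_erase _ _ (Finset.mem_univ i)] at hc
    have hmem : ∑ j ∈ Finset.univ.erase i, c j • e j ∈ ⨆ j < i, E j := by
      refine Submodule.sum_mem _ fun j hj ↦ ?_
      by_cases hcj : c j = 0
      · simp [hcj]
      · have hlt : j < i := lt_of_le_of_ne (hmax j hcj) (Finset.ne_of_mem_erase hj)
        exact Submodule.smul_mem _ _ (le_iSup₂_of_le (f := fun j (_ : j < i) ↦ E j) j hlt le_rfl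
          (he j))
    refine he' i ((Submodule.smul_mem_iff _ hi).mp ?_)
    rw [eq_neg_of_add_eq_zero_left hc]
    exact Submodule.neg_mem _ hmem
  refine ⟨e, hli, fun i ↦ (Submodule.eq_of_le_of_finrank_eq (hspan_le i) ?_).symm⟩
  rw [hdim, Set.image_eq_range, finrank_span_eq_card (b := fun j : Set.Iic i ↦ e j)
    (hli.comp _ Subtype.val_injective)]
  simp

open LinearMap.BilinForm in
/-- Isometries act transitively on complete isotropic flags. -/
theorem exists_isometry_map_flag {k V : Type*} [Field k] [AddCommGroup V] [Module k V]
    [FiniteDimensional k V] {B : LinearMap.BilinForm k V} (h2 : (2 : k) ≠ 0) (hB : B.IsSymm)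
    (hnd : B.Nondegenerate) {n : ℕ} (hV : finrank k V = 2 * n) (E F : Fin n → Submodule k V)
    (hE : Monotone E) (hF : Monotone F) (hEdim : ∀ i, finrank k ↥(E i) = (i : ℕ) + 1)
    (hFdim : ∀ i, finrank k ↥(F i) = (i : ℕ) + 1)
    (hEiso : ∀ i, ∀ v ∈ E i, ∀ w ∈ E i, B v w = 0)
    (hFiso : ∀ i, ∀ v ∈ F i, ∀ w ∈ F i, B v w = 0) :
    ∃ g : V ≃ₗ[k] V, (∀ v w, B (g v) (g w) = B v w) ∧
      ∀ i, (E i).map (g : V →ₗ[k] V) = F i := by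
  have hflag : ∀ G : Fin n → Submodule k V, Monotone G →
      (∀ i, finrank k ↥(G i) = (i : ℕ) + 1) → (∀ i, ∀ v ∈ G i, ∀ w ∈ G i, B v w = 0) →
      ∃ b : Basis (Fin n ⊕ Fin n) k V,
        (∀ i, G i = Submodule.span k ((fun j ↦ b (Sum.inl j)) '' Set.Iic i)) ∧
        ∀ s t, B (b s) (b t) = if s = t.swap then 1 else 0 := fun G hG hGdim hGiso ↦ by
    obtain ⟨e, hli, hspan⟩ := exists_adapted_family G hG hGdim
    have he : ∀ i, e i ∈ G i := fun i ↦ by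
      rw [hspan]
      exact Submodule.subset_span ⟨i, Set.self_mem_Iic, rfl⟩
    have hiso : ∀ v ∈ Submodule.span k (Set.range e), ∀ w ∈ Submodule.span k (Set.range e),
        B v w = 0 := fun v hv w hw ↦ by
      refine Submodule.span_induction₂ (p := fun v w _ _ ↦ B v w = 0) ?_ ?_ ?_ ?_ ?_ ?_ ?_ hv hw
      · rintro _ _ ⟨i, rfl⟩ ⟨j, rfl⟩
        exact hGiso (max i j) _ (hG (le_max_left i j) (he i)) _ (hG (le_max_right i j) (he j))
      all_goals simp +contextual
    have hL := orthogonal_eq_self_of_finrank hnd hiso (by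
      rw [hV, finrank_span_eq_card hli, Fintype.card_fin])
    obtain ⟨b, hbe, hb⟩ := exists_hyperbolic_basis h2 hB hnd hL (Basis.span hli)
    refine ⟨b, fun i ↦ ?_, hb⟩
    simp only [hbe, Basis.span_apply, hspan i]
  obtain ⟨b, hbE, hb⟩ := hflag E hE hEdim hEiso
  obtain ⟨c, hcF, hc⟩ := hflag F hF hFdim hFiso
  refine ⟨b.equiv c (Equiv.refl _), fun v w ↦ ?_, fun i ↦ ?_⟩
  · have h : B.compl₁₂ (b.equiv c (Equiv.refl _) : V →ₗ[k] V)
        (b.equiv c (Equiv.refl _) : V →ₗ[k] V) = B :=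
      b.ext fun s ↦ b.ext fun t ↦ by simp [hb, hc]
    exact LinearMap.congr_fun₂ h v w
  · rw [hbE, hcF, Submodule.map_span, Set.image_image]
    simp

/-- Let `k` be a field of characteristic `≠ 2`, `V` a `k`-vector space of
dimension `2n` (`n ≥ 1`) and `q` a hyperbolic (nondegenerate) quadratic form on `V`.  Given two
maximal isotropic flags `E₁ ⊂ ⋯ ⊂ Eₙ` and `F₁ ⊂ ⋯ ⊂ Fₙ` (with `dim Eᵢ = dim Fᵢ = i`, indexed
here by `i : Fin n` with `dim (E i) = i + 1`), there is an isometry `g` of `(V, q)` with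
`det g = 1` and `g (Eᵢ) = Fᵢ` for all `i` iff `dim (Eₙ ⊓ Fₙ) ≡ n [MOD 2]`. -/
theorem stmt5 {k : Type*} [Field k] (hchar : (2 : k) ≠ 0)
    {V : Type*} [AddCommGroup V] [Module k V] [FiniteDimensional k V]
    (n : ℕ) (hn : 1 ≤ n) (hdim : finrank k V = 2 * n)
    (q : QuadraticForm k V)
    (hnondeg : ∀ v : V, (∀ w : V, QuadraticMap.polar q v w = 0) → v = 0)
    (hhyp : ∃ L : Submodule k V, finrank k L = n ∧ ∀ v ∈ L, q v = 0)
    (E F : Fin n → Submodule k V)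
    (hEmono : Monotone E) (hFmono : Monotone F)
    (hEdim : ∀ i, finrank k ↥(E i) = (i : ℕ) + 1)
    (hFdim : ∀ i, finrank k ↥(F i) = (i : ℕ) + 1)
    (hEiso : ∀ i, ∀ v ∈ E i, q v = 0)
    (hFiso : ∀ i, ∀ v ∈ F i, q v = 0) :
    (∃ g : V ≃ₗ[k] V, (∀ v : V, q (g v) = q v) ∧
        LinearMap.det (g : V →ₗ[k] V) = 1 ∧
        ∀ i, Submodule.map (g : V →ₗ[k] V) (E i) = F i) ↔
      finrank k ↥(E ⟨n - 1, by omega⟩ ⊓ F ⟨n - 1, by omega⟩) % 2 = n % 2 := by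
  have hBapp : ∀ v w, q.polarBilin v w = QuadraticMap.polar q v w := fun _ _ ↦ rfl
  have hB : LinearMap.BilinForm.IsSymm q.polarBilin := ⟨fun v w ↦ QuadraticMap.polar_comm q v w⟩
  have hnd : LinearMap.BilinForm.Nondegenerate q.polarBilin :=
    ⟨hnondeg, fun v hv ↦ hnondeg v fun w ↦ (QuadraticMap.polar_comm q v w).trans (hv w)⟩
  have hpolar : ∀ L : Submodule k V, (∀ v ∈ L, q v = 0) → ∀ v ∈ L, ∀ w ∈ L,
      q.polarBilin v w = 0 := fun L hL v hv w hw ↦ by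
    rw [hBapp, QuadraticMap.polar, hL _ (L.add_mem hv hw), hL v hv, hL w hw]
    simp
  have hlast := hEdim ⟨n - 1, by omega⟩
  rw [show n - 1 + 1 = n by omega] at hlast
  have hL := LinearMap.BilinForm.orthogonal_eq_self_of_finrank hnd
    (hpolar _ (hEiso ⟨n - 1, by omega⟩)) (by rw [hdim, hlast])
  have hdet : ∀ g : V ≃ₗ[k] V, (∀ v w, q.polarBilin (g v) (g w) = q.polarBilin v w) →
      (∀ i, Submodule.map (g : V →ₗ[k] V) (E i) = F i) →
      (LinearMap.det (g : V →ₗ[k] V) = 1 ↔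
        finrank k ↥(E ⟨n - 1, by omega⟩ ⊓ F ⟨n - 1, by omega⟩) % 2 = n % 2) := fun g hg hEF ↦ by
    have hle := Submodule.finrank_mono
      (inf_le_left : E ⟨n - 1, by omega⟩ ⊓ F ⟨n - 1, by omega⟩ ≤ E ⟨n - 1, by omega⟩)
    rw [hlast] at hle
    have hne : (-1 : k) ≠ 1 := fun h ↦ hchar (by linear_combination -h)
    rw [LinearMap.BilinForm.det_eq_neg_one_pow hchar hB hnd hL
      (n - finrank k ↥(E ⟨n - 1, by omega⟩ ⊓ F ⟨n - 1, by omega⟩)) g hg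
      (by rw [hEF, hlast]; omega), neg_one_pow_eq_one_iff_even hne, Nat.even_iff]
    omega
  constructor
  · rintro ⟨g, hgq, hg1, hEF⟩
    refine (hdet g (fun v w ↦ ?_) hEF).mp hg1
    simp only [hBapp, QuadraticMap.polar, ← map_add, hgq]
  · intro h
    obtain ⟨g, hg, hEF⟩ := exists_isometry_map_flag hchar hB hnd hdim E F hEmono hFmono hEdim hFdim
      (fun i ↦ hpolar _ (hEiso i)) (fun i ↦ hpolar _ (hFiso i))
    refine ⟨g, fun v ↦ ?_, (hdet g hg hEF).mpr h, hEF⟩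
    have hv := hg v v
    simp only [hBapp, QuadraticMap.polar_self, nsmul_eq_mul, Nat.cast_ofNat] at hv
    exact mul_left_cancel₀ hchar hv
end

section
/- Let E ⊆ ℂ ⊗_ℝ W be a complex subspace that is totally isotropic for Q. Then the restriction of the real part map r to E is an injective ℝ-linear map E → W; in particular 2 · dim_ℂ E ≤ dim_ℝ W. -/
open Module TensorProduct

/-- The ℝ-linear "real part" map `ℂ ⊗[ℝ] W → W` determined by `z ⊗ w ↦ Re(z) • w`. -/
noncomputable def realPartMap (W : Type*) [AddCommGroup W] [Module ℝ W] :
    ℂ ⊗[ℝ] W →ₗ[ℝ] W :=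
  TensorProduct.lift ((LinearMap.lsmul ℝ W) ∘ₗ Complex.reLm)

theorem realPartMap_tmul {W : Type*} [AddCommGroup W] [Module ℝ W] (z : ℂ) (w : W) :
    realPartMap W (z ⊗ₜ[ℝ] w) = z.re • w := by
  simp [realPartMap]

theorem exists_eq_one_tmul_realPartMap_add_I_tmul {W : Type*} [AddCommGroup W] [Module ℝ W]
    (x : ℂ ⊗[ℝ] W) :
    ∃ b : W, x = (1 : ℂ) ⊗ₜ[ℝ] realPartMap W x + Complex.I ⊗ₜ[ℝ] b := by
  induction x with
  | zero => exact ⟨0, by simp⟩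
  | tmul z w =>
    refine ⟨z.im • w, ?_⟩
    rw [realPartMap_tmul, ← TensorProduct.smul_tmul, ← TensorProduct.smul_tmul,
      ← TensorProduct.add_tmul]
    congr 1
    simp [Complex.re_add_im]
  | add x y hx hy =>
    obtain ⟨b, hb⟩ := hx
    obtain ⟨c, hc⟩ := hy
    refine ⟨b + c, ?_⟩
    rw [map_add, TensorProduct.tmul_add, TensorProduct.tmul_add, add_add_add_comm, ← hb, ← hc]

theorem eq_zero_of_realPartMap_eq_zero_of_baseChange_eq_zero {W : Type*} [AddCommGroup W]
    [Module ℝ W] {q : QuadraticForm ℝ W} (hq : q.Anisotropic) {x : ℂ ⊗[ℝ] W}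
    (hr : realPartMap W x = 0) (hx : q.baseChange ℂ x = 0) : x = 0 := by
  obtain ⟨b, hb⟩ := exists_eq_one_tmul_realPartMap_add_I_tmul x
  rw [hr, TensorProduct.tmul_zero, zero_add] at hb
  rw [hb, QuadraticForm.baseChange_tmul] at hx
  have hqb : q b = 0 := by simpa using hx
  rw [hb, hq b hqb, TensorProduct.tmul_zero]

/-- Let `W` be a finite-dimensional real vector space with a positive definite
quadratic form `q`, and let `Q` be the complexification of `q` on `ℂ ⊗[ℝ] W`.  If `E` is a
complex subspace of `ℂ ⊗[ℝ] W` which is totally isotropic for `Q`, then the real part map is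
injective on `E`; in particular `2 * dim_ℂ E ≤ dim_ℝ W`. -/
theorem stmt8 {W : Type*} [AddCommGroup W] [Module ℝ W] [FiniteDimensional ℝ W]
    (q : QuadraticForm ℝ W) (hq : q.PosDef)
    (E : Submodule ℂ (ℂ ⊗[ℝ] W))
    (hEiso : ∀ x ∈ E, q.baseChange ℂ x = 0) :
    Set.InjOn (realPartMap W) (E : Set (ℂ ⊗[ℝ] W)) ∧
      2 * finrank ℂ E ≤ finrank ℝ W := by
  have hinj : Set.InjOn (realPartMap W) (E : Set (ℂ ⊗[ℝ] W)) := fun x hx y hy hxy =>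
    sub_eq_zero.mp <| eq_zero_of_realPartMap_eq_zero_of_baseChange_eq_zero hq.anisotropic
      (by rw [map_sub, hxy, sub_self]) (hEiso _ (E.sub_mem hx hy))
  refine ⟨hinj, ?_⟩
  rw [← finrank_real_of_complex E]
  exact LinearMap.finrank_le_finrank_of_injective
    (f := realPartMap W ∘ₗ E.subtype.restrictScalars ℝ)
    fun x y hxy => Subtype.ext (hinj x.2 y.2 hxy)
end

section
/- Suppose dim_ℝ W = 2n and let E ⊆ ℂ ⊗_ℝ W be a complex subspace that is totally isotropic for Q with dim_ℂ E = n. Then the restriction of the real part map r to E (viewed as a real vector space of dimension 2n) is an ℝ-linear isomorphism from E onto W. -/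
open Module TensorProduct

/-- Every element of `ℂ ⊗[ℝ] W` whose real part vanishes is of the form `I ⊗ w`. -/
theorem exists_eq_I_tmul_of_realPartMap_eq_zero {W : Type*} [AddCommGroup W] [Module ℝ W]
    {x : ℂ ⊗[ℝ] W} (hx : realPartMap W x = 0) : ∃ w : W, x = Complex.I ⊗ₜ[ℝ] w := by
  have key : ∀ y : ℂ ⊗[ℝ] W,
      ∃ w : W, y = (1 : ℂ) ⊗ₜ[ℝ] realPartMap W y + Complex.I ⊗ₜ[ℝ] w := by
    intro y
    induction y with
    | zero => exact ⟨0, by simp⟩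
    | tmul z v =>
      refine ⟨z.im • v, ?_⟩
      have hre : realPartMap W (z ⊗ₜ[ℝ] v) = z.re • v := by simp [realPartMap]
      rw [hre, ← TensorProduct.smul_tmul, ← TensorProduct.smul_tmul, ← TensorProduct.add_tmul]
      congr 1
      apply Complex.ext <;> simp
    | add a b ha hb =>
      obtain ⟨v, hv⟩ := ha
      obtain ⟨w, hw⟩ := hb
      refine ⟨v + w, ?_⟩
      rw [map_add, TensorProduct.tmul_add, TensorProduct.tmul_add, add_add_add_comm, ← hv, ← hw]
  obtain ⟨w, hw⟩ := key x
  exact ⟨w, by simpa [hx] using hw⟩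

/-- Let `W` be a real vector space of dimension `2n` with a positive definite
quadratic form `q`, and let `Q` be the complexification of `q` on `ℂ ⊗[ℝ] W`.  If `E` is an
`n`-dimensional complex subspace of `ℂ ⊗[ℝ] W` totally isotropic for `Q`, then the restriction
of the real part map to `E` is an ℝ-linear isomorphism from `E` onto `W`. -/
theorem stmt9 {W : Type*} [AddCommGroup W] [Module ℝ W] [FiniteDimensional ℝ W]
    (n : ℕ) (hdim : finrank ℝ W = 2 * n)
    (q : QuadraticForm ℝ W) (hq : q.PosDef)
    (E : Submodule ℂ (ℂ ⊗[ℝ] W))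
    (hEdim : finrank ℂ E = n)
    (hEiso : ∀ x ∈ E, q.baseChange ℂ x = 0) :
    Function.Bijective
      ((realPartMap W) ∘ₗ (E.subtype.restrictScalars ℝ) : ↥E →ₗ[ℝ] W) := by
  have hfin : finrank ℝ E = finrank ℝ W := by
    rw [← finrank_mul_finrank ℝ ℂ E, Complex.finrank_real_complex, hEdim, hdim]
  have : FiniteDimensional ℝ E := FiniteDimensional.trans ℝ ℂ E
  have hinj : Function.Injective
      ((realPartMap W) ∘ₗ (E.subtype.restrictScalars ℝ) : ↥E →ₗ[ℝ] W) := by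
    rw [injective_iff_map_eq_zero]
    rintro ⟨x, hxE⟩ hx
    obtain ⟨w, rfl⟩ := exists_eq_I_tmul_of_realPartMap_eq_zero (x := x) hx
    have hw : q w = 0 := by
      have h := hEiso _ hxE
      rw [QuadraticForm.baseChange_tmul] at h
      simpa using h
    simp [hq.anisotropic w hw]
  exact ⟨hinj, (LinearMap.injective_iff_surjective_of_finrank_eq_finrank hfin).1 hinj⟩
end

section
/- Suppose dim_ℝ W = 2n with n ≥ 1. Then ℂ ⊗_ℝ W contains a complex subspace E with dim_ℂ E = n that is totally isotropic for Q; that is, the complexification of a positive definite quadratic form on a 2n-dimensional real vector space is a hyperbolic quadratic form. -/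
open Module TensorProduct

theorem QuadraticMap.PosDef.exists_orthonormal_basis {W : Type*} [AddCommGroup W] [Module ℝ W]
    [FiniteDimensional ℝ W] {q : QuadraticForm ℝ W} (hq : q.PosDef) :
    ∃ b : Basis (Fin (finrank ℝ W)) ℝ W,
      ∀ i j, QuadraticMap.associated (R := ℝ) q (b i) (b j) = if i = j then 1 else 0 := by
  obtain ⟨v, hv⟩ := LinearMap.BilinForm.exists_orthogonal_basis
    (QuadraticForm.associated_isSymm ℝ q)
  have hpos (i) : 0 < q (v i) := hq _ (v.ne_zero i)
  have hne (i) : (√(q (v i)))⁻¹ ≠ 0 := inv_ne_zero (Real.sqrt_pos.2 (hpos i)).ne'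
  refine ⟨v.unitsSMul fun i ↦ Units.mk0 _ (hne i), fun i j ↦ ?_⟩
  simp only [Basis.unitsSMul_apply, Units.smul_mk0, map_smul, LinearMap.smul_apply, smul_eq_mul]
  split_ifs with h
  · subst h
    rw [QuadraticMap.associated_eq_self_apply]
    have := Real.sq_sqrt (hpos i).le
    have := (Real.sqrt_pos.2 (hpos i)).ne'
    field_simp
    linarith
  · have := hv h
    simp_all [LinearMap.IsOrthoᵢ, Function.onFun]

/-- If the bilinear form associated to `Q` vanishes on all pairs from `s`, then `Q` vanishes on the
span of `s`. -/
theorem QuadraticMap.eq_zero_of_mem_span {R M : Type*} [CommRing R] [Invertible (2 : R)]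
    [AddCommGroup M] [Module R M] (Q : QuadraticForm R M) {s : Set M}
    (h : ∀ x ∈ s, ∀ y ∈ s, QuadraticMap.associated (R := R) Q x y = 0) {x : M}
    (hx : x ∈ Submodule.span R s) : Q x = 0 := by
  rw [← QuadraticMap.associated_eq_self_apply R Q x]
  have key : ∀ y ∈ s, QuadraticMap.associated (R := R) Q y x = 0 := fun y hy ↦
    (Submodule.span_le (p := LinearMap.ker (QuadraticMap.associated (R := R) Q y))).2
      (fun z hz ↦ h y hy z hz) hx
  exact (Submodule.span_le
    (p := LinearMap.ker ((QuadraticMap.associated (R := R) Q).flip x))).2 (fun y hy ↦ key y hy) hx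

/-- Let `W` be a real vector space of dimension `2n` (`n ≥ 1`) with a positive
definite quadratic form `q`.  Then the complexification `Q` of `q` on `ℂ ⊗[ℝ] W` admits an
`n`-dimensional complex totally isotropic subspace; i.e. `Q` is hyperbolic. -/
theorem stmt10 {W : Type*} [AddCommGroup W] [Module ℝ W] [FiniteDimensional ℝ W]
    (n : ℕ) (hn : 1 ≤ n) (hdim : finrank ℝ W = 2 * n)
    (q : QuadraticForm ℝ W) (hq : q.PosDef) :
    ∃ E : Submodule ℂ (ℂ ⊗[ℝ] W),
      finrank ℂ E = n ∧ ∀ x ∈ E, q.baseChange ℂ x = 0 := by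
  obtain ⟨b, hb⟩ := hq.exists_orthonormal_basis
  let σ : Fin n ⊕ Fin n ≃ Fin (finrank ℝ W) :=
    finSumFinEquiv.trans (finCongr (by omega))
  let c : Basis (Fin n ⊕ Fin n) ℂ (ℂ ⊗[ℝ] W) := (b.reindex σ.symm).baseChange ℂ
  have hc (i j) : QuadraticMap.associated (R := ℂ) (q.baseChange ℂ) (c i) (c j) =
      if i = j then 1 else 0 := by
    rw [QuadraticForm.associated_baseChange]
    simp [c, LinearMap.BilinForm.baseChange_tmul, hb]
  let g : Fin n → ℂ ⊗[ℝ] W := fun j ↦ c (.inl j) + Complex.I • c (.inr j)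
  have hg : LinearIndependent ℂ g := by
    rw [Fintype.linearIndependent_iff]
    intro a ha j
    simpa [g, Finsupp.single_apply] using congrArg (fun x ↦ c.repr x (.inl j)) ha
  refine ⟨Submodule.span ℂ (Set.range g), by simpa using finrank_span_eq_card hg,
    fun x hx ↦ QuadraticMap.eq_zero_of_mem_span _ ?_ hx⟩
  rintro _ ⟨i, rfl⟩ _ ⟨j, rfl⟩
  simp only [g, map_add, map_smul, LinearMap.add_apply, LinearMap.smul_apply, hc]
  by_cases h : i = j <;> simp [h]
end

section
/- Let k be a field with char k ≠ 2, let n ≥ 1, and let V be a k-vector space of dimension 2n with basis e₁, …, e_{2n}. Let q be a quadratic form on V with polar form B(u,v) = q(u+v) − q(u) − q(v), and suppose: (i) q(e_i) = 0 for all i; (ii) B(e_i, e_{2n+1−i}) = 1 for all i; and (iii) B(e_i, e_j) = 0 whenever i + j ≤ 2n. Let q_std be the standard hyperbolic quadratic form on V defined by q_std(∑ x_i e_i) = x₁ x_{2n} + x₂ x_{2n−1} + … + x_n x_{n+1}. Then there exists a linear automorphism g of V such that g(e_i) = e_i for i = 1, …, n and q(v) = q_std(g v) for all v ∈ V. -/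
open Module

/-- Let `k` be a field of characteristic not two, and let `q` be a quadratic form vanishing on the
first half of a basis indexed by `ι ⊕ ι`, such that the pairing between the two halves is perfect.
Then an automorphism fixing the first half carries `q` to the standard hyperbolic form. -/
theorem QuadraticMap.exists_linearEquiv_hyperbolic {k V ι : Type*} [Field k] (hchar : (2 : k) ≠ 0)
    [AddCommGroup V] [Module k V] [Fintype ι] [DecidableEq ι]
    (b : Basis (ι ⊕ ι) k V) (q : QuadraticForm k V)
    (hl : ∀ i j, polar q (b (.inl i)) (b (.inl j)) = 0)
    (hdet : IsUnit (Matrix.of fun i j => polar q (b (.inl i)) (b (.inr j))).det) :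
    ∃ g : V ≃ₗ[k] V, (∀ i, g (b (.inl i)) = b (.inl i)) ∧
      ∀ v, q v = ∑ i, b.repr (g v) (.inl i) * b.repr (g v) (.inr i) := by
  set M : Matrix ι ι k := Matrix.of fun i j => polar q (b (.inl i)) (b (.inr j)) with hM
  set B : LinearMap.BilinForm k V := q.polarBilin with hB
  have hBself (v : V) : B v v = 2 * q v := by
    simp [hB, polar_self]
  have hBsymm (u v : V) : B u v = B v u := by
    simp [hB, polar_comm q u v]
  have hBl (i j : ι) : B (b (.inl i)) (b (.inl j)) = 0 := hl i j
  -- vectors dual to the first half of the basis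
  let f (j : ι) : V := ∑ l, M⁻¹ l j • b (.inr l)
  have hf (i j : ι) : B (b (.inl i)) (f j) = if i = j then 1 else 0 := by
    have h := congrFun (congrFun (Matrix.mul_nonsing_inv M hdet) i) j
    rw [Matrix.mul_apply, Matrix.one_apply] at h
    rw [← h, map_sum]
    refine Finset.sum_congr rfl fun l _ => ?_
    rw [map_smul, smul_eq_mul, mul_comm]
    rfl
  -- correct them so that they span a totally isotropic subspace
  let f' (j : ι) : V := f j - (2 : k)⁻¹ • ∑ l, B (f j) (f l) • b (.inl l)
  have hf' (i j : ι) : B (b (.inl i)) (f' j) = if i = j then 1 else 0 := by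
    simp [f', hf, hBl]
  have hff (i j : ι) : B (f i) (f' j) = (2 : k)⁻¹ * B (f i) (f j) := by
    have h (l : ι) : B (f i) (b (.inl l)) = if l = i then 1 else 0 := by rw [hBsymm, hf]
    simp only [f', map_sub, map_smul, map_sum, h, smul_eq_mul, mul_ite, mul_one, mul_zero,
      Finset.sum_ite_eq', Finset.mem_univ, if_true]
    rw [hBsymm (f j) (f i)]
    field_simp
    ring
  have hff' (i j : ι) : B (f' i) (f' j) = 0 := by
    have h : B (f' i) (f' j) =
        B (f i) (f' j) - (2 : k)⁻¹ * ∑ l, B (f i) (f l) * B (b (.inl l)) (f' j) := by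
      conv_lhs => rw [show f' i = f i - (2 : k)⁻¹ • ∑ l, B (f i) (f l) • b (.inl l) from rfl]
      simp only [map_sub, map_smul, map_sum, LinearMap.sub_apply, LinearMap.smul_apply,
        LinearMap.sum_apply, smul_eq_mul]
    rw [h, hff]
    simp [hf']
  let h : V →ₗ[k] V := b.constr k (Sum.elim (fun i => b (.inl i)) f')
  have hhl (i : ι) : h (b (.inl i)) = b (.inl i) := by simp [h]
  have hhr (i : ι) : h (b (.inr i)) = f' i := by simp [h]
  let β : LinearMap.BilinForm k V := ∑ i,
    (LinearMap.BilinForm.linMulLin (b.coord (.inl i)) (b.coord (.inr i)) +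
      LinearMap.BilinForm.linMulLin (b.coord (.inr i)) (b.coord (.inl i)))
  have hβ (u v : V) : β u v = ∑ i,
      (b.repr u (.inl i) * b.repr v (.inr i) + b.repr u (.inr i) * b.repr v (.inl i)) := by
    simp [β]
  have hBβ : B.compl₁₂ h h = β := by
    refine b.ext fun i => b.ext fun j => ?_
    rw [hβ, LinearMap.compl₁₂_apply]
    rcases i with i | i <;> rcases j with j | j
    · simp [hhl, hBl]
    · simp [hhl, hhr, hf', Finsupp.single_apply, eq_comm]
    · simp [hhl, hhr, hBsymm (f' i), hf', Finsupp.single_apply, eq_comm]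
    · simp [hhr, hff']
  have hBβ' (u v : V) : B (h u) (h v) = β u v := by rw [← hBβ, LinearMap.compl₁₂_apply]
  have hinj : Function.Injective h := by
    rw [injective_iff_map_eq_zero]
    intro v hv
    have hz (j : V) : β v j = 0 := by rw [← hBβ', hv]; simp
    refine b.ext_elem fun i => ?_
    rcases i with i | i
    · simpa [hβ, Finsupp.single_apply] using hz (b (.inr i))
    · simpa [hβ, Finsupp.single_apply] using hz (b (.inl i))
  have : FiniteDimensional k V := b.finiteDimensional_of_finite
  let H : V ≃ₗ[k] V := LinearEquiv.ofInjectiveEndo h hinj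
  have hH (v : V) : H v = h v := rfl
  refine ⟨H.symm, fun i => ?_, fun v => ?_⟩
  · rw [LinearEquiv.symm_apply_eq, hH, hhl]
  · obtain ⟨w, rfl⟩ := H.surjective v
    rw [LinearEquiv.symm_apply_apply, hH]
    apply mul_left_cancel₀ hchar
    rw [← hBself, hBβ', hβ, Finset.mul_sum]
    exact Finset.sum_congr rfl fun i _ => by ring

/-- The indices below `n`, followed by their reflections, enumerate `Fin (2 * n)`. -/
noncomputable def finSumFinEquivRev (n : ℕ) : Fin n ⊕ Fin n ≃ Fin (2 * n) :=
  Equiv.ofBijective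
    (Sum.elim (fun i => i.castLE (by omega)) fun i => Fin.rev (i.castLE (by omega))) <| by
    rw [Fintype.bijective_iff_injective_and_card]
    refine ⟨?_, by simp [two_mul]⟩
    rintro (i | i) (j | j) hij <;> simp [Fin.ext_iff] at hij ⊢ <;> omega

/-- Let `k` be a field of characteristic `≠ 2` and `V` a `k`-vector space with
basis `e₁, …, e_{2n}` (indexed here by `i : Fin (2*n)`, so `eᵢ` is `e ⟨i-1⟩` and
`e_{2n+1-i} = e (Fin.rev ⟨i-1⟩)`).  Suppose a quadratic form `q` satisfies `q(eᵢ) = 0`,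
`B(eᵢ, e_{2n+1-i}) = 1` and `B(eᵢ, eⱼ) = 0` for `i + j ≤ 2n` (1-indexed), where `B` is the polar
form of `q`.  Then there is a linear automorphism `g` of `V` fixing `e₁, …, eₙ` with
`q v = q_std (g v)` for all `v`, where `q_std (∑ xᵢ eᵢ) = x₁ x₂ₙ + ⋯ + xₙ xₙ₊₁` is the standard
hyperbolic form. -/
theorem stmt11 {k : Type*} [Field k] (hchar : (2 : k) ≠ 0)
    {V : Type*} [AddCommGroup V] [Module k V]
    (n : ℕ) (hn : 1 ≤ n) (e : Basis (Fin (2 * n)) k V)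
    (q : QuadraticForm k V)
    (h1 : ∀ i : Fin (2 * n), q (e i) = 0)
    (h2 : ∀ i : Fin (2 * n), QuadraticMap.polar q (e i) (e (Fin.rev i)) = 1)
    (h3 : ∀ i j : Fin (2 * n), (i : ℕ) + (j : ℕ) + 2 ≤ 2 * n →
      QuadraticMap.polar q (e i) (e j) = 0) :
    ∃ g : V ≃ₗ[k] V,
      (∀ i : Fin (2 * n), (i : ℕ) < n → g (e i) = e i) ∧
      ∀ v : V, q v =
        ∑ i : Fin (2 * n),
          if (i : ℕ) < n then e.repr (g v) i * e.repr (g v) (Fin.rev i) else 0 := by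
  let σ := finSumFinEquivRev n
  have hσl (i : Fin n) : σ (.inl i) = i.castLE (by omega) := rfl
  have hσr (i : Fin n) : σ (.inr i) = Fin.rev (i.castLE (by omega)) := rfl
  let b := e.reindex σ.symm
  have hb (s : Fin n ⊕ Fin n) : b s = e (σ s) := by simp [b]
  have hrepr (v : V) (s : Fin n ⊕ Fin n) : b.repr v s = e.repr v (σ s) := by simp [b]
  obtain ⟨g, hg, hq⟩ := QuadraticMap.exists_linearEquiv_hyperbolic hchar b q
    (fun i j => by
      rw [hb, hb]
      exact h3 _ _ (by simp [hσl]; omega))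
    (by
      rw [Matrix.det_of_isLowerTriangular]
      · simp [hb, hσl, hσr, h2]
      · intro i j hij
        rw [OrderDual.toDual_lt_toDual] at hij
        rw [Matrix.of_apply, hb, hb]
        exact h3 _ _ (by simp [hσl, hσr]; omega))
  refine ⟨g, fun i hi => ?_, fun v => ?_⟩
  · have h := hg ⟨i, hi⟩
    rw [hb] at h
    exact h
  · rw [hq, ← σ.sum_comp, Fintype.sum_sum_type, Finset.sum_eq_zero (s := Finset.univ)
      (f := fun i => if (σ (.inr i) : ℕ) < n then _ else _), add_zero]
    · refine Finset.sum_congr rfl fun i _ => ?_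
      rw [if_pos (by simp [hσl]), hrepr, hrepr, hσl, hσr]
    · intro i _
      exact if_neg (by simp [hσr]; omega)
end
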